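/- Let d be a positive integer, G a finite simple graph, and f a labeling in Z_d of some subset S of the edges of G. If the subgraph of G consisting of the edges in S (with their endpoints), labeled by f, is compatible, then there is an extension f_E of f to all edges of G such that (G,f_E) is a compatible e-labeled graph. -/

import Mathlib

open SimpleGraph Finset

/-- `fV` is a valid v-labeling of the e-labeled graph `(G, fE)`:
the label of each edge is the sum (mod `d`) of the labels of its endpoints. -/
def validVLabeling {V : Type*} {d : ℕ} (G : SimpleGraph V) (fE : Sym2 V → ZMod d)
    (fV : V → ZMod d) : Prop :=
  ∀ ⦃u v : V⦄, G.Adj u v → fE s(u, v) = fV u + fV v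

/-- `fE` is an additive e-labeling of `G`: some valid v-labeling exists. -/
def IsAdditive {V : Type*} {d : ℕ} (G : SimpleGraph V) (fE : Sym2 V → ZMod d) : Prop :=
  ∃ fV : V → ZMod d, validVLabeling G fE fV

/-- The even cycle property: for every cycle (closed walk) of even length,
the alternating sum of the labels of its edge sequence vanishes, i.e. the sum of the
labels at odd positions equals the sum of the labels at even positions. -/
def EvenCycleProperty {V : Type*} {d : ℕ} (G : SimpleGraph V) (fE : Sym2 V → ZMod d) : Prop :=
  ∀ ⦃v : V⦄ (p : G.Walk v v), Even p.length → (p.edges.map fE).alternatingSum = 0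

/-- The odd cycle property (for `d` even): for every cycle (closed walk) of odd length,
`(d/2) · (sum of the labels of its edges)` vanishes in `ZMod d`. -/
def OddCycleProperty {V : Type*} (d : ℕ) (G : SimpleGraph V) (fE : Sym2 V → ZMod d) : Prop :=
  ∀ ⦃v : V⦄ (p : G.Walk v v), Odd p.length →
    ((d / 2 : ℕ) : ZMod d) * (p.edges.map fE).sum = 0

/-- `(G, fE)` is compatible: if `d` is odd it has the even cycle property, and
if `d` is even it has both the even and the odd cycle properties. -/
def Compatible {V : Type*} (d : ℕ) (G : SimpleGraph V) (fE : Sym2 V → ZMod d) : Prop :=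
  (Odd d ∧ EvenCycleProperty G fE) ∨
  (Even d ∧ EvenCycleProperty G fE ∧ OddCycleProperty d G fE)

/-- The label forced at the start of a walk by the label `x` at its end, if every edge label
is the sum of the labels of its endpoints. -/
def walkTransport {V : Type*} {d : ℕ} {G : SimpleGraph V} (f : Sym2 V → ZMod d) :
    ∀ {u v : V}, G.Walk u v → ZMod d → ZMod d
  | _, _, .nil, x => x
  | _, _, .cons (u := u) (v := w) _ p, x => f s(u, w) - walkTransport f p x

section Transport

variable {V : Type*} {d : ℕ} {G : SimpleGraph V} (f : Sym2 V → ZMod d)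

theorem walkTransport_append {u v w : V} (p : G.Walk u v) (q : G.Walk v w) (x : ZMod d) :
    walkTransport f (p.append q) x = walkTransport f p (walkTransport f q x) := by
  induction p with
  | nil => rfl
  | cons h p ih => simp [walkTransport, ih]

theorem walkTransport_reverse {u v : V} (p : G.Walk u v) (x : ZMod d) :
    walkTransport f p (walkTransport f p.reverse x) = x := by
  induction p generalizing x with
  | nil => rfl
  | cons h p ih =>
    simp [walkTransport, walkTransport_append, ih, Sym2.eq_swap]

theorem walkTransport_eq_alternatingSum {u v : V} (p : G.Walk u v) (x : ZMod d) :
    walkTransport f p x = (p.edges.map f).alternatingSum + (-1) ^ p.length * x := by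
  induction p with
  | nil => simp [walkTransport]
  | cons h p ih =>
    simp only [walkTransport, ih, Walk.edges_cons, List.map_cons, List.alternatingSum_cons,
      Walk.length_cons, pow_succ]
    ring

theorem walkTransport_of_validVLabeling {fV : V → ZMod d} (hf : validVLabeling G f fV)
    {u v : V} (p : G.Walk u v) : walkTransport f p (fV v) = fV u := by
  induction p with
  | nil => rfl
  | cons h p ih => simp [walkTransport, ih, hf h]

end Transport

theorem List.mul_alternatingSum_eq_mul_sum {R : Type*} [CommRing R] {k : R} (hk : k * 2 = 0)
    (l : List R) : k * l.alternatingSum = k * l.sum := by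
  induction l with
  | nil => simp
  | cons a l ih =>
    rw [List.alternatingSum_cons, List.sum_cons]
    linear_combination ih - hk * l.alternatingSum

theorem ZMod.half_mul_two {d : ℕ} (hd : Even d) : ((d / 2 : ℕ) : ZMod d) * 2 = 0 := by
  have h : ((d / 2 * 2 : ℕ) : ZMod d) = 0 := by
    rw [Nat.div_mul_cancel hd.two_dvd, ZMod.natCast_self]
  exact_mod_cast h

theorem ZMod.exists_two_mul_eq_of_odd {d : ℕ} (hd : Odd d) (a : ZMod d) :
    ∃ c : ZMod d, 2 * c = a := by
  have h : ((2 : ℕ) : ZMod d) * ((2 : ℕ) : ZMod d)⁻¹ = 1 :=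
    ZMod.coe_mul_inv_eq_one 2 (Nat.coprime_two_left.mpr hd)
  refine ⟨((2 : ℕ) : ZMod d)⁻¹ * a, ?_⟩
  rw [Nat.cast_ofNat] at h ⊢
  rw [← mul_assoc, h, one_mul]

theorem ZMod.exists_two_mul_eq_of_half_mul_eq_zero {d : ℕ} (hpos : 0 < d) (hd : Even d)
    {a : ZMod d} (ha : ((d / 2 : ℕ) : ZMod d) * a = 0) : ∃ c : ZMod d, 2 * c = a := by
  have : NeZero d := ⟨hpos.ne'⟩
  obtain ⟨m, rfl⟩ := ZMod.natCast_zmod_surjective a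
  obtain ⟨k, rfl⟩ := hd.two_dvd
  have hk : 0 < k := by lia
  rw [← Nat.cast_mul, ZMod.natCast_eq_zero_iff, Nat.mul_div_cancel_left k two_pos,
    mul_comm 2 k] at ha
  obtain ⟨c, rfl⟩ := Nat.dvd_of_mul_dvd_mul_left hk ha
  exact ⟨c, by push_cast; rfl⟩

theorem Compatible.evenCycleProperty {V : Type*} {d : ℕ} {G : SimpleGraph V}
    {f : Sym2 V → ZMod d} (h : Compatible d G f) : EvenCycleProperty G f :=
  h.elim And.right fun h => h.2.1

theorem Compatible.exists_two_mul_eq_alternatingSum {V : Type*} {d : ℕ} {G : SimpleGraph V}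
    {f : Sym2 V → ZMod d} (hd : 0 < d) (h : Compatible d G f) {r : V} (p : G.Walk r r)
    (hp : Odd p.length) : ∃ c : ZMod d, 2 * c = (p.edges.map f).alternatingSum := by
  rcases h with ⟨hodd, -⟩ | ⟨heven, -, h⟩
  · exact ZMod.exists_two_mul_eq_of_odd hodd _
  · refine ZMod.exists_two_mul_eq_of_half_mul_eq_zero hd heven ?_
    rw [List.mul_alternatingSum_eq_mul_sum (ZMod.half_mul_two heven)]
    exact h p hp

/-- Some label at `r` is fixed by transport along every closed walk at `r`. -/
theorem Compatible.exists_walkTransport_eq_self {V : Type*} {d : ℕ} {G : SimpleGraph V}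
    {f : Sym2 V → ZMod d} (hd : 0 < d) (h : Compatible d G f) (r : V) :
    ∃ c : ZMod d, ∀ p : G.Walk r r, walkTransport f p c = c := by
  have heven (p : G.Walk r r) (hp : Even p.length) (x : ZMod d) : walkTransport f p x = x := by
    rw [walkTransport_eq_alternatingSum, h.evenCycleProperty p hp, hp.neg_one_pow]
    ring
  by_cases hr : ∃ q : G.Walk r r, Odd q.length
  · obtain ⟨q, hq⟩ := hr
    obtain ⟨c, hc⟩ := h.exists_two_mul_eq_alternatingSum hd q hq
    refine ⟨c, fun p => ?_⟩
    rcases Nat.even_or_odd p.length with hp | hp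
    · exact heven p hp c
    · have hqp := heven (q.append p) (by rw [Walk.length_append]; exact hq.add_odd hp) c
      rw [walkTransport_append, walkTransport_eq_alternatingSum f q, hq.neg_one_pow, ← hc] at hqp
      linear_combination -hqp
  · exact ⟨0, fun p => heven p (Nat.not_odd_iff_even.mp fun hp => hr ⟨p, hp⟩) 0⟩

theorem Compatible.isAdditive {V : Type*} {d : ℕ} {G : SimpleGraph V}
    {f : Sym2 V → ZMod d} (hd : 0 < d) (h : Compatible d G f) : IsAdditive G f := by
  choose c hc using h.exists_walkTransport_eq_self hd
  have hindep {u r : V} (p q : G.Walk u r) :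
      walkTransport f p (c r) = walkTransport f q (c r) := by
    have := hc r (q.reverse.append p)
    rw [walkTransport_append] at this
    rw [← this, walkTransport_reverse, this]
  let root (v : V) : V := (G.connectedComponentMk v).out
  have hroot (v : V) : Nonempty (G.Walk v (root v)) :=
    (ConnectedComponent.exact (G.connectedComponentMk v).out_eq).symm
  refine ⟨fun v => walkTransport f (hroot v).some (c (root v)), fun u v huv => ?_⟩
  have hr : root u = root v :=
    congrArg Quot.out (ConnectedComponent.sound huv.reachable)
  have key {a b : V} (hab : a = b) (p : G.Walk u a) (q : G.Walk v b) :
      f s(u, v) = walkTransport f p (c a) + walkTransport f q (c b) := by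
    subst hab
    rw [hindep p (.cons huv q)]
    simp [walkTransport]
  exact key hr _ _

theorem IsAdditive.compatible {V : Type*} {d : ℕ} {G : SimpleGraph V}
    {f : Sym2 V → ZMod d} (h : IsAdditive G f) : Compatible d G f := by
  obtain ⟨fV, hf⟩ := h
  have key {v : V} (p : G.Walk v v) :
      (p.edges.map f).alternatingSum + (-1) ^ p.length * fV v = fV v := by
    rw [← walkTransport_eq_alternatingSum, walkTransport_of_validVLabeling f hf]
  have heven : EvenCycleProperty G f := fun v p hp => by
    simpa [hp.neg_one_pow] using key p
  rcases Nat.even_or_odd d with hd | hd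
  · refine .inr ⟨hd, heven, fun v p hp => ?_⟩
    have hp' := key p
    rw [hp.neg_one_pow] at hp'
    have hk := ZMod.half_mul_two hd
    rw [← List.mul_alternatingSum_eq_mul_sum hk]
    linear_combination ((d / 2 : ℕ) : ZMod d) * hp' + hk * fV v
  · exact .inl ⟨hd, heven⟩

/-- If a subset `S` of the edges of `G` is labeled by `f` so that the
subgraph formed by the edges in `S` is compatible, then `f` extends to a labeling `fE` of
all edges of `G` such that `(G, fE)` is compatible. -/
theorem compatible_extend_partial {V : Type*} [Fintype V] (d : ℕ) (hd : 0 < d)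
    (G : SimpleGraph V) (S : Set (Sym2 V)) (hS : S ⊆ G.edgeSet)
    (f : Sym2 V → ZMod d) (hcomp : Compatible d (SimpleGraph.fromEdgeSet S) f) :
    ∃ fE : Sym2 V → ZMod d, (∀ e ∈ S, fE e = f e) ∧ Compatible d G fE := by
  obtain ⟨fV, hf⟩ := hcomp.isAdditive hd
  refine ⟨Sym2.lift ⟨fun u v => fV u + fV v, fun u v => add_comm _ _⟩, ?_,
    IsAdditive.compatible ⟨fV, fun u v _ => rfl⟩⟩
  intro e he
  induction e with
  | h u v => exact (hf ((fromEdgeSet_adj S).mpr ⟨he, (hS he).ne⟩)).symm
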